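/- arXiv:1803.01156 — 4 statements merged into one kernel-verified Lean document; each statement's English description precedes it below -/
import Mathlib

section
/- Let 0 < p < 1, θ > 0, and k ≥ 1 an integer. Then ∫_0^∞ θ p^k e^{-θx} (1 - e^{-θx})^{k-1} / (A(p,k) (1 - p e^{-θx})^k) dx = 1, where A(p,k) := Σ_{j=k}^∞ p^j / j. In particular the EGTL density is a probability density on [0,∞). -/
open Real MeasureTheory

/-- The tail of the logarithmic series, `A(p,k) = Σ_{j=k}^∞ p^j / j`. -/
noncomputable def Apk (p : ℝ) (k : ℕ) : ℝ := ∑' j : ℕ, p ^ (j + k) / ((j + k : ℕ) : ℝ)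

open Filter Topology

theorem Apk_summable {u : ℝ} (hu : |u| < 1) (m : ℕ) :
    Summable fun j : ℕ => u ^ (j + (m + 1)) / ((j + (m + 1) : ℕ) : ℝ) := by
  have h := (summable_nat_add_iff m).2 (Real.hasSum_pow_div_log_of_abs_lt_one hu).summable
  refine h.congr fun j => ?_
  push_cast
  ring_nf

theorem Apk_succ_eq {u : ℝ} (hu : |u| < 1) (m : ℕ) :
    Apk u (m + 1) = -log (1 - u) - ∑ i ∈ Finset.range m, u ^ (i + 1) / ((i : ℝ) + 1) := by
  have h := Real.hasSum_pow_div_log_of_abs_lt_one hu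
  have h2 := h.summable.sum_add_tsum_nat_add m
  rw [h.tsum_eq] at h2
  rw [← h2, Apk, add_sub_cancel_left]
  refine tsum_congr fun j => ?_
  push_cast
  ring_nf

theorem Apk_succ_pos {p : ℝ} (hp0 : 0 < p) (hp1 : p < 1) (m : ℕ) : 0 < Apk p (m + 1) :=
  (Apk_summable (abs_lt.2 ⟨by linarith, hp1⟩) m).tsum_pos (fun j => by positivity) 0
    (by positivity)

theorem hasDerivAt_Apk {u : ℝ} (hu : |u| < 1) (m : ℕ) :
    HasDerivAt (fun v => Apk v (m + 1)) (u ^ m / (1 - u)) u := by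
  have h1u : 1 - u ≠ 0 := by linarith [(abs_lt.1 hu).2]
  have hlog : HasDerivAt (fun v : ℝ => -log (1 - v)) (1 / (1 - u)) u := by
    refine (((hasDerivAt_id u).const_sub 1).log h1u).fun_neg.congr_deriv ?_
    simp [neg_div]
  have hsum : HasDerivAt (fun v : ℝ => ∑ i ∈ Finset.range m, v ^ (i + 1) / ((i : ℝ) + 1))
      (∑ i ∈ Finset.range m, u ^ i) u := by
    refine HasDerivAt.fun_sum fun i _ => ?_
    refine ((hasDerivAt_pow (i + 1) u).div_const ((i : ℝ) + 1)).congr_deriv ?_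
    have : (i : ℝ) + 1 ≠ 0 := by positivity
    push_cast
    field_simp
  have hd := hlog.fun_sub hsum
  have hval : 1 / (1 - u) - ∑ i ∈ Finset.range m, u ^ i = u ^ m / (1 - u) := by
    have := geom_sum_mul_neg u m
    field_simp
    linarith
  rw [hval] at hd
  refine hd.congr_of_eventuallyEq ?_
  have : ∀ᶠ v : ℝ in 𝓝 u, |v| < 1 := continuous_abs.continuousAt.eventually_lt_const hu
  exact this.mono fun v hv => Apk_succ_eq hv m

theorem hasDerivAt_egtl_substitution {p θ x : ℝ} (h : 1 - p * exp (-θ * x) ≠ 0) :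
    HasDerivAt (fun y => p * (1 - exp (-θ * y)) / (1 - p * exp (-θ * y)))
      (θ * p * (1 - p) * exp (-θ * x) / (1 - p * exp (-θ * x)) ^ 2) x := by
  have he : HasDerivAt (fun y => exp (-θ * y)) (exp (-θ * x) * (-θ)) x := by
    simpa using ((hasDerivAt_id x).const_mul (-θ)).exp
  refine (((he.const_sub 1).const_mul p).fun_div
    ((he.const_mul p).const_sub 1) h).congr_deriv ?_
  generalize exp (-θ * x) = e at h ⊢
  field_simp
  ring

/-- The EGTL density integrates to one on `[0,∞)`. -/
theorem egtl_density_integral_one (p θ : ℝ) (hp0 : 0 < p) (hp1 : p < 1) (hθ : 0 < θ)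
    (k : ℕ) (hk : 1 ≤ k) :
    ∫ x in Set.Ioi (0 : ℝ),
        θ * p ^ k * Real.exp (-θ * x) * (1 - Real.exp (-θ * x)) ^ (k - 1) /
          (Apk p k * (1 - p * Real.exp (-θ * x)) ^ k) = 1 := by
  obtain ⟨m, rfl⟩ : ∃ m, k = m + 1 := ⟨k - 1, by omega⟩
  simp only [Nat.add_sub_cancel]
  have hA := Apk_succ_pos hp0 hp1 m
  set u : ℝ → ℝ := fun y => p * (1 - exp (-θ * y)) / (1 - p * exp (-θ * y)) with hu
  have hexp : ∀ x : ℝ, 0 ≤ x → exp (-θ * x) ≤ 1 := fun x hx =>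
    exp_le_one_iff.2 (by nlinarith)
  have hden : ∀ x : ℝ, 0 ≤ x → 0 < 1 - p * exp (-θ * x) := fun x hx => by
    nlinarith [hexp x hx]
  have hu1 : ∀ x : ℝ, 0 ≤ x → |u x| < 1 := fun x hx => by
    have h0 : 0 ≤ u x :=
      div_nonneg (mul_nonneg hp0.le (sub_nonneg.2 (hexp x hx))) (hden x hx).le
    rw [abs_of_nonneg h0, hu]
    simp only
    rw [div_lt_one (hden x hx)]
    linarith
  have hderiv : ∀ x : ℝ, 0 ≤ x → HasDerivAt (fun y => Apk (u y) (m + 1) / Apk p (m + 1))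
      (θ * p ^ (m + 1) * exp (-θ * x) * (1 - exp (-θ * x)) ^ m /
        (Apk p (m + 1) * (1 - p * exp (-θ * x)) ^ (m + 1))) x := fun x hx => by
    have hd := (hden x hx).ne'
    refine (((hasDerivAt_Apk (hu1 x hx) m).comp x
      (hasDerivAt_egtl_substitution hd)).div_const (Apk p (m + 1))).congr_deriv ?_
    have h1 : 1 - u x = (1 - p) / (1 - p * exp (-θ * x)) := by
      simp only [hu]
      generalize exp (-θ * x) = e at hd ⊢
      field_simp
      ring
    have hp : 1 - p ≠ 0 := by linarith
    rw [h1]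
    simp only [hu, div_pow, mul_pow]
    generalize exp (-θ * x) = e at hd ⊢
    field_simp
    ring
  have hlim : Tendsto (fun y => Apk (u y) (m + 1) / Apk p (m + 1)) atTop (𝓝 1) := by
    have he : Tendsto (fun y : ℝ => exp (-θ * y)) atTop (𝓝 0) :=
      tendsto_exp_atBot.comp (tendsto_id.const_mul_atTop_of_neg (by linarith))
    have hup : Tendsto u atTop (𝓝 p) := by
      have hq : Tendsto u atTop (𝓝 (p * (1 - 0) / (1 - p * 0))) :=
        ((he.const_sub 1).const_mul p).div ((he.const_mul p).const_sub 1) (by simp)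
      simpa only [mul_zero, sub_zero, mul_one, div_one] using hq
    have hc := (hasDerivAt_Apk (abs_lt.2 ⟨by linarith, hp1⟩ : |p| < 1) m).continuousAt
    simpa [hA.ne'] using (hc.tendsto.comp hup).div_const (Apk p (m + 1))
  rw [integral_Ioi_of_hasDerivAt_of_nonneg (hderiv 0 le_rfl).continuousAt.continuousWithinAt
    (fun x hx => hderiv x (le_of_lt hx)) (fun x hx => ?_) hlim]
  · simp [hu, Apk]
  · have hx0 : 0 ≤ x := le_of_lt hx
    have := hden x hx0
    have := sub_nonneg.2 (hexp x hx0)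
    positivity
end

section
/- Let 0 < p < 1, θ > 0, k ≥ 1 an integer, and t < θ a real number. Then ∫_0^∞ e^{tx} g_k(x; p, θ) dx = (p^k / A(p,k)) · Σ_{i=0}^∞ C(k-1+i, i) p^i B(i - t/θ + 1, k), where B(a,b) = ∫_0^1 u^{a-1}(1-u)^{b-1} du is the Beta function and C denotes binomial coefficients; both sides are finite. -/
open Real MeasureTheory

/-- The EGTL density. -/
noncomputable def egtl (p θ : ℝ) (k : ℕ) (x : ℝ) : ℝ :=
  θ * p ^ k * Real.exp (-θ * x) * (1 - Real.exp (-θ * x)) ^ (k - 1) /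
    (Apk p k * (1 - p * Real.exp (-θ * x)) ^ k)

/-- The Beta function `B(a,b) = ∫_0^1 u^{a-1} (1-u)^{b-1} du`. -/
noncomputable def betaFn (a b : ℝ) : ℝ :=
  ∫ u in (0 : ℝ)..1, u ^ (a - 1) * (1 - u) ^ (b - 1)

/-- The map `x ↦ exp (-θ x)` sends the open half-line onto the open unit interval. -/
lemma image_exp_neg_mul_Ioi {θ : ℝ} (hθ : 0 < θ) :
    (fun x => Real.exp (-θ * x)) '' Set.Ioi 0 = Set.Ioo 0 1 := by
  ext u
  constructor
  · rintro ⟨x, hx, rfl⟩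
    have hx : 0 < x := hx
    exact ⟨Real.exp_pos _, by simpa using mul_pos hθ hx⟩
  · rintro ⟨hu0, hu1⟩
    refine ⟨-Real.log u / θ, div_pos (neg_pos.2 (Real.log_neg hu0 hu1)) hθ, ?_⟩
    have : -θ * (-Real.log u / θ) = Real.log u := by field_simp
    simp only [this, Real.exp_log hu0]

lemma integrableOn_rpow_mul_one_sub_pow {s : ℝ} (hs : -1 < s) (m : ℕ) :
    IntegrableOn (fun u : ℝ => u ^ s * (1 - u) ^ m) (Set.Ioo 0 1) := by
  have h : IntegrableOn (fun u : ℝ => u ^ s) (Set.Ioo 0 1) :=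
    (intervalIntegral.integrableOn_Ioo_rpow_iff one_pos).2 hs
  refine h.mul_bdd (c := 1) (by fun_prop) ?_
  filter_upwards [ae_restrict_mem measurableSet_Ioo] with u hu
  have h0 : 0 ≤ 1 - u := by linarith [hu.2]
  rw [Real.norm_of_nonneg (pow_nonneg h0 m)]
  exact pow_le_one₀ h0 (by linarith [hu.1])

lemma betaFn_eq_integral_Ioo (i m : ℕ) (s : ℝ) :
    betaFn (i + s + 1) (m + 1 : ℕ) =
      ∫ u in Set.Ioo (0 : ℝ) 1, u ^ i * (u ^ s * (1 - u) ^ m) := by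
  rw [betaFn, intervalIntegral.integral_of_le zero_le_one, integral_Ioc_eq_integral_Ioo]
  refine setIntegral_congr_fun measurableSet_Ioo fun u hu => ?_
  have h1 : (i : ℝ) + s + 1 - 1 = s + i := by ring
  have h2 : ((m + 1 : ℕ) : ℝ) - 1 = m := by push_cast; ring
  simp only [h1, h2, Real.rpow_natCast, Real.rpow_add_natCast hu.1.ne']
  ring

/-- Termwise integration of the negative binomial series against the kernel
`u ^ s * (1 - u) ^ m`. -/
lemma hasSum_choose_mul_betaFn {p s : ℝ} (hp0 : 0 < p) (hp1 : p < 1) (hs : -1 < s) (m : ℕ) :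
    HasSum (fun i : ℕ => ((m + i).choose i : ℝ) * p ^ i * betaFn (i + s + 1) (m + 1 : ℕ))
      (∫ u in Set.Ioo (0 : ℝ) 1, u ^ s * (1 - u) ^ m / (1 - p * u) ^ (m + 1)) := by
  set κ : ℝ → ℝ := fun u => u ^ s * (1 - u) ^ m with hκ
  have hκ_int : IntegrableOn κ (Set.Ioo 0 1) := integrableOn_rpow_mul_one_sub_pow hs m
  have hκ_nonneg : ∀ u ∈ Set.Ioo (0 : ℝ) 1, 0 ≤ κ u := fun u hu =>
    mul_nonneg (Real.rpow_nonneg hu.1.le s) (pow_nonneg (by linarith [hu.2]) m)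
  have hpow_le : ∀ i : ℕ, ∀ u ∈ Set.Ioo (0 : ℝ) 1, u ^ i * κ u ≤ κ u := fun i u hu =>
    mul_le_of_le_one_left (hκ_nonneg u hu) (pow_le_one₀ hu.1.le hu.2.le)
  have hpow_int : ∀ i : ℕ, IntegrableOn (fun u => u ^ i * κ u) (Set.Ioo 0 1) := fun i => by
    refine hκ_int.bdd_mul (c := 1) (by fun_prop) ?_
    filter_upwards [ae_restrict_mem measurableSet_Ioo] with u hu
    rw [Real.norm_of_nonneg (pow_nonneg hu.1.le i)]
    exact pow_le_one₀ hu.1.le hu.2.le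
  have hchoose : ∀ i : ℕ, (i + m).choose m = (m + i).choose i := fun i => by
    rw [add_comm, Nat.choose_symm_add]
  have hcoef : Summable (fun i : ℕ => ((m + i).choose i : ℝ) * p ^ i) := by
    simpa only [hchoose] using summable_choose_mul_geometric_of_norm_lt_one m
      (r := p) (by rwa [Real.norm_of_nonneg hp0.le])
  have hcoef_nonneg : ∀ i : ℕ, 0 ≤ ((m + i).choose i : ℝ) * p ^ i := fun i => by positivity
  have hnorm : Summable fun i : ℕ =>
      ∫ u in Set.Ioo (0 : ℝ) 1, ‖((m + i).choose i : ℝ) * p ^ i * (u ^ i * κ u)‖ := by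
    refine Summable.of_nonneg_of_le (fun i => integral_nonneg fun u => norm_nonneg _)
      (fun i => ?_) (hcoef.mul_right (∫ u in Set.Ioo (0 : ℝ) 1, κ u))
    rw [← integral_const_mul]
    refine setIntegral_mono_on ((hpow_int i).const_mul _).norm (hκ_int.const_mul _)
      measurableSet_Ioo fun u hu => ?_
    rw [Real.norm_of_nonneg (mul_nonneg (hcoef_nonneg i)
      (mul_nonneg (pow_nonneg hu.1.le i) (hκ_nonneg u hu)))]
    exact mul_le_mul_of_nonneg_left (hpow_le i u hu) (hcoef_nonneg i)
  have key := hasSum_integral_of_summable_integral_norm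
    (fun i => (hpow_int i).const_mul (((m + i).choose i : ℝ) * p ^ i)) hnorm
  simp only [integral_const_mul, hκ, ← betaFn_eq_integral_Ioo] at key
  convert! key using 1
  refine setIntegral_congr_fun measurableSet_Ioo fun u hu => ?_
  have hpu : ‖p * u‖ < 1 := by
    rw [Real.norm_of_nonneg (mul_nonneg hp0.le hu.1.le)]
    nlinarith [hu.1, hu.2]
  have hsum := (hasSum_choose_mul_geometric_of_norm_lt_one m hpu).mul_right (κ u)
  simp only [hchoose] at hsum
  rw [div_eq_inv_mul, ← one_div, ← hsum.tsum_eq]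
  refine tsum_congr fun i => ?_
  rw [hκ, mul_pow]
  ring

lemma integrableOn_rpow_mul_one_sub_pow_div {p s : ℝ} (hp0 : 0 < p) (hp1 : p < 1) (hs : -1 < s)
    (m n : ℕ) :
    IntegrableOn (fun u : ℝ => u ^ s * (1 - u) ^ m / (1 - p * u) ^ n) (Set.Ioo 0 1) := by
  simp only [div_eq_mul_inv]
  refine (integrableOn_rpow_mul_one_sub_pow hs m).mul_bdd (c := ((1 - p) ^ n)⁻¹)
    (Measurable.aestronglyMeasurable (by fun_prop)) ?_
  filter_upwards [ae_restrict_mem measurableSet_Ioo] with u hu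
  have h1 : 0 < 1 - p := by linarith
  have h2 : 1 - p ≤ 1 - p * u := by nlinarith [hu.2]
  rw [Real.norm_of_nonneg (inv_nonneg.2 (pow_nonneg (h1.le.trans h2) n))]
  gcongr

/-- The substitution `u = exp (-θ x)` in the integrand of the moment generating function. -/
lemma exp_mul_egtl_eq {p θ t : ℝ} (hθ : 0 < θ) (m : ℕ) (x : ℝ) :
    Real.exp (t * x) * egtl p θ (m + 1) x =
      p ^ (m + 1) / Apk p (m + 1) * (|-θ * Real.exp (-θ * x)| •
        (Real.exp (-θ * x) ^ (-(t / θ)) * (1 - Real.exp (-θ * x)) ^ m /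
          (1 - p * Real.exp (-θ * x)) ^ (m + 1))) := by
  have habs : |-θ * Real.exp (-θ * x)| = θ * Real.exp (-θ * x) := by
    rw [abs_mul, abs_neg, abs_of_pos hθ, abs_of_pos (Real.exp_pos _)]
  have hexp : Real.exp (-θ * x) ^ (-(t / θ)) = Real.exp (t * x) := by
    rw [← Real.exp_mul]
    congr 1
    field_simp
  rw [habs, hexp, egtl, Nat.add_sub_cancel, smul_eq_mul, div_eq_mul_inv, mul_inv]
  ring

/-- The moment generating function of the EGTL distribution:
`E(e^{tX}) = (p^k / A(p,k)) Σ_{i=0}^∞ C(k-1+i, i) p^i B(i - t/θ + 1, k)`,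
and both sides are finite. -/
theorem egtl_mgf_beta (p θ t : ℝ) (hp0 : 0 < p) (hp1 : p < 1) (hθ : 0 < θ)
    (k : ℕ) (hk : 1 ≤ k) (ht : t < θ) :
    IntegrableOn (fun x => Real.exp (t * x) * egtl p θ k x) (Set.Ioi (0 : ℝ)) ∧
    Summable (fun i : ℕ =>
      ((k - 1 + i).choose i : ℝ) * p ^ i * betaFn (i - t / θ + 1) k) ∧
    ∫ x in Set.Ioi (0 : ℝ), Real.exp (t * x) * egtl p θ k x
      = p ^ k / Apk p k *
        ∑' i : ℕ, ((k - 1 + i).choose i : ℝ) * p ^ i * betaFn (i - t / θ + 1) k := by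
  obtain ⟨m, rfl⟩ : ∃ m, k = m + 1 := ⟨k - 1, by omega⟩
  have hs : -1 < -(t / θ) := neg_lt_neg ((div_lt_one hθ).2 ht)
  have hderiv : ∀ x ∈ Set.Ioi (0 : ℝ), HasDerivWithinAt (fun x => Real.exp (-θ * x))
      (-θ * Real.exp (-θ * x)) (Set.Ioi 0) x := fun x _ => by
    simpa [mul_comm] using (((hasDerivAt_id x).const_mul (-θ)).exp).hasDerivWithinAt
  have hinj : Set.InjOn (fun x => Real.exp (-θ * x)) (Set.Ioi 0) := fun x _ y _ hxy =>
    mul_left_cancel₀ (neg_ne_zero.2 hθ.ne') (Real.exp_injective hxy)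
  have hint := (integrableOn_image_iff_integrableOn_abs_deriv_smul measurableSet_Ioi hderiv hinj
    (fun u : ℝ => u ^ (-(t / θ)) * (1 - u) ^ m / (1 - p * u) ^ (m + 1))).1
    (by rw [image_exp_neg_mul_Ioi hθ]
        exact integrableOn_rpow_mul_one_sub_pow_div hp0 hp1 hs m (m + 1))
  have hcov := integral_image_eq_integral_abs_deriv_smul measurableSet_Ioi hderiv hinj
    (fun u : ℝ => u ^ (-(t / θ)) * (1 - u) ^ m / (1 - p * u) ^ (m + 1))
  rw [image_exp_neg_mul_Ioi hθ] at hcov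
  have hsum := hasSum_choose_mul_betaFn hp0 hp1 hs m
  simp only [← sub_eq_add_neg] at hsum
  simp only [exp_mul_egtl_eq hθ, Nat.add_sub_cancel]
  refine ⟨hint.const_mul _, hsum.summable, ?_⟩
  rw [integral_const_mul, ← hcov, hsum.tsum_eq]
end

section
/- Let 0 < p < 1 and θ > 0. Then the hazard rate h_1(x) = -p θ e^{-θx} / ((1 - p e^{-θx}) log(1 - p e^{-θx})) of the EL distribution tends to θ as x → ∞. -/
open Real Filter

/-- `log (1 + u) / u` tends to `1` as `u → 0`. -/
theorem tendsto_inv_mul_log_one_add :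
    Tendsto (fun u : ℝ => u⁻¹ * Real.log (1 + u)) (nhdsWithin 0 {0}ᶜ) (nhds 1) := by
  simpa using (Real.hasDerivAt_log one_ne_zero).tendsto_slope_zero

/-- The hazard rate of the EL distribution tends to `θ` as `x → ∞`. -/
theorem el_hazard_limit_infty (p θ : ℝ) (hp0 : 0 < p) (hp1 : p < 1) (hθ : 0 < θ) :
    Tendsto
      (fun x => -(p * θ * Real.exp (-θ * x)) /
        ((1 - p * Real.exp (-θ * x)) * Real.log (1 - p * Real.exp (-θ * x))))
      atTop (nhds θ) := by
  have hexp : Tendsto (fun x : ℝ => Real.exp (-θ * x)) atTop (nhds 0) :=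
    Real.tendsto_exp_atBot.comp (tendsto_id.const_mul_atTop_of_neg (neg_neg_of_pos hθ))
  have hu : Tendsto (fun x : ℝ => -(p * Real.exp (-θ * x))) atTop (nhds 0) := by
    simpa using (hexp.const_mul p).neg
  have hu' : Tendsto (fun x : ℝ => -(p * Real.exp (-θ * x))) atTop (nhdsWithin 0 {0}ᶜ) :=
    tendsto_nhdsWithin_of_tendsto_nhds_of_eventually_within _ hu
      (Eventually.of_forall fun x => neg_ne_zero.mpr (mul_pos hp0 (Real.exp_pos _)).ne')
  have hprod := (hu.const_add 1).mul (tendsto_inv_mul_log_one_add.comp hu')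
  have hlim := (hprod.inv₀ (by norm_num)).const_mul θ
  rw [add_zero, mul_one, inv_one, mul_one] at hlim
  refine hlim.congr fun x => ?_
  simp only [Function.comp_apply, ← sub_eq_add_neg, mul_inv, inv_inv, div_eq_mul_inv]
  ring
end

section
/- Let 0 < p < 1, θ > 0, and k ≥ 2 an integer. Then the hazard rate h_k(x) := g_k(x; p, θ) / (1 - G_k(x)) of the EGTL distribution tends to 0 as x → 0⁺. -/
open Real MeasureTheory Filter

/-- The cdf of the EGTL distribution. -/
noncomputable def egtlCDF (p θ : ℝ) (k : ℕ) (x : ℝ) : ℝ := ∫ t in (0 : ℝ)..x, egtl p θ k t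

theorem continuousOn_egtl (p θ : ℝ) (hp0 : 0 < p) (hp1 : p < 1) (hθ : 0 < θ) (k : ℕ) :
    ContinuousOn (egtl p θ k) (Set.Ici 0) := by
  have heq : egtl p θ k = fun x => (Apk p k)⁻¹ *
      (θ * p ^ k * Real.exp (-θ * x) * (1 - Real.exp (-θ * x)) ^ (k - 1) /
        (1 - p * Real.exp (-θ * x)) ^ k) := by
    funext x
    rw [egtl, div_mul_eq_div_div_swap, div_eq_inv_mul _ (Apk p k)]
  rw [heq]
  refine continuousOn_const.mul (ContinuousOn.div (by fun_prop) (by fun_prop) ?_)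
  intro x hx
  have hexp : Real.exp (-θ * x) ≤ 1 :=
    Real.exp_le_one_iff.mpr (by nlinarith [mul_nonneg hθ.le (Set.mem_Ici.mp hx)])
  exact pow_ne_zero k (by nlinarith)

theorem tendsto_egtlCDF_zero (p θ : ℝ) (hp0 : 0 < p) (hp1 : p < 1) (hθ : 0 < θ) (k : ℕ) :
    Tendsto (egtlCDF p θ k) (nhdsWithin 0 (Set.Ioi 0)) (nhds 0) := by
  have hint : IntegrableOn (egtl p θ k) (Set.uIcc 0 1) := by
    rw [Set.uIcc_of_le zero_le_one]
    exact ((continuousOn_egtl p θ hp0 hp1 hθ k).mono Set.Icc_subset_Ici_self).integrableOn_Icc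
  have hcont := intervalIntegral.continuousOn_primitive_interval hint 0 Set.left_mem_uIcc
  rw [Set.uIcc_of_le zero_le_one, ContinuousWithinAt, intervalIntegral.integral_same,
    nhdsWithin_Icc_eq_nhdsGE zero_lt_one] at hcont
  exact hcont.mono_left (nhdsWithin_mono 0 Set.Ioi_subset_Ici_self)

/-- For `k ≥ 2`, the hazard rate of the EGTL distribution tends to `0` as `x → 0⁺`. -/
theorem egtl_hazard_limit_zero (p θ : ℝ) (hp0 : 0 < p) (hp1 : p < 1) (hθ : 0 < θ)
    (k : ℕ) (hk : 2 ≤ k) :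
    Tendsto (fun x => egtl p θ k x / (1 - egtlCDF p θ k x))
      (nhdsWithin 0 (Set.Ioi 0)) (nhds 0) := by
  have hg : Tendsto (egtl p θ k) (nhdsWithin 0 (Set.Ioi 0)) (nhds 0) := by
    have h := continuousOn_egtl p θ hp0 hp1 hθ k 0 Set.self_mem_Ici
    have h0 : egtl p θ k 0 = 0 := by
      simp [egtl, zero_pow (show k - 1 ≠ 0 by lia)]
    rw [ContinuousWithinAt, h0] at h
    exact h.mono_left (nhdsWithin_mono 0 Set.Ioi_subset_Ici_self)
  simpa [Pi.div_def] using hg.div ((tendsto_egtlCDF_zero p θ hp0 hp1 hθ k).const_sub 1) (by norm_num)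
end
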